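/- Let V be a nonempty finite set and let (·,·) be a negative definite symmetric ℤ-valued bilinear form on L := ℤ^V with standard basis {E_v}_{v∈V}, satisfying (E_u,E_v) ≥ 0 for u ≠ v; let the dual graph G (edge between u ≠ v iff (E_u,E_v) > 0) be connected; let Z_K ∈ ℚ^V be the unique vector with (Z_K,E_v) = (E_v,E_v)+2 for all v, and χ(x) := −(x, x−Z_K)/2. Fix l' with (l',E_v) a nonnegative integer for every v, fix a cycle Z ∈ L with all coordinates ≥ 1, and assume there exists 0 < l ≤ Z with χ(−l'+l) ≤ χ(−l'). Let Z' be a ≤-minimal element of the set of cycles 0 < Z' ≤ Z realizing the maximum t(Z,l') = max_{0<Z''≤Z} Σ_i T(Z''_i,l'). Then t(Z,l') = Σ_i ( −(l',Z'_i) − χ(Z'_i) + 1 ), the sum being over the connected components Z'_i of Z'. -/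

import Mathlib

open Classical

noncomputable section

/-- The rational pairing on `ℚ^V` determined by the integral matrix `M`. -/
def pairQ {V : Type} [Fintype V] (M : Matrix V V ℤ) (x y : V → ℚ) : ℚ :=
  ∑ u, ∑ v, x u * (M u v : ℚ) * y v

/-- The Riemann–Roch expression `χ(x) = −(x, x − Z_K)/2`. -/
def chiQ {V : Type} [Fintype V] (M : Matrix V V ℤ) (ZK : V → ℚ) (x : V → ℚ) : ℚ :=
  - pairQ M x (x - ZK) / 2

/-- Inclusion of integral cycles into `ℚ^V`. -/
def toQ {V : Type} (l : V → ℤ) : V → ℚ := fun v => (l v : ℚ)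

/-- The dual graph: `u ~ v` iff `u ≠ v` and `M u v > 0` (for symmetric `M`). -/
def dualGraph {V : Type} (M : Matrix V V ℤ) : SimpleGraph V :=
  SimpleGraph.fromRel (fun u v => 0 < M u v)

/-- The support `|Z|` of a cycle. -/
def supp {V : Type} (Z : V → ℤ) : Set V := {v | Z v ≠ 0}

/-- The dual graph induced on the support of a cycle. -/
def inducedOnSupp {V : Type} (M : Matrix V V ℤ) (Z : V → ℤ) :
    SimpleGraph (supp Z) :=
  (dualGraph M).induce (supp Z)

/-- The part `Z_c` of a cycle `Z` corresponding to a connected component `c`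
of the dual graph induced on the support of `Z`:  it agrees with `Z` on the
component and vanishes elsewhere. -/
def compCycle {V : Type} (M : Matrix V V ℤ) (Z : V → ℤ)
    (c : (inducedOnSupp M Z).ConnectedComponent) : V → ℤ := fun v =>
  if h : Z v ≠ 0 then
    (if (inducedOnSupp M Z).connectedComponentMk ⟨v, h⟩ = c then Z v else 0)
  else 0

/-- The sum `Σ_i F(Z_i)` of a quantity `F` over the connected components
`Z = Σ_i Z_i` of a cycle. -/
def sumComp {V : Type} [Fintype V] (M : Matrix V V ℤ)
    (F : (V → ℤ) → ℚ) (Z : V → ℤ) : ℚ :=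
  ∑ᶠ c : (inducedOnSupp M Z).ConnectedComponent, F (compCycle M Z c)

end

theorem toQ_add {V : Type} (a b : V → ℤ) : toQ (a + b) = toQ a + toQ b := by
  ext v; simp [toQ]

theorem toQ_zero {V : Type} : toQ (0 : V → ℤ) = 0 := by
  ext v; simp [toQ]

theorem toQ_single {V : Type} [DecidableEq V] (v : V) : toQ (Pi.single v 1) = Pi.single v 1 := by
  ext u
  by_cases h : u = v
  · subst h; simp [toQ]
  · simp [toQ, h]

theorem toQ_sum {V : Type} {ι : Type*} (s : Finset ι) (a : ι → V → ℤ) :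
    toQ (∑ i ∈ s, a i) = ∑ i ∈ s, toQ (a i) := by
  ext v; simp [toQ]

section Pairing

variable {V : Type} [Fintype V] (M : Matrix V V ℤ)

theorem pairQ_add_left (x y z : V → ℚ) : pairQ M (x + y) z = pairQ M x z + pairQ M y z := by
  simp [pairQ, add_mul, Finset.sum_add_distrib]

theorem pairQ_add_right (x y z : V → ℚ) : pairQ M x (y + z) = pairQ M x y + pairQ M x z := by
  simp [pairQ, mul_add, Finset.sum_add_distrib]

theorem pairQ_neg_left (x y : V → ℚ) : pairQ M (-x) y = -pairQ M x y := by
  simp [pairQ]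

theorem pairQ_neg_right (x y : V → ℚ) : pairQ M x (-y) = -pairQ M x y := by
  simp [pairQ]

theorem pairQ_zero_right (x : V → ℚ) : pairQ M x 0 = 0 := by
  simp [pairQ]

theorem pairQ_zero_left (x : V → ℚ) : pairQ M 0 x = 0 := by
  simp [pairQ]

theorem pairQ_sum_right {ι : Type*} (s : Finset ι) (x : V → ℚ) (y : ι → V → ℚ) :
    pairQ M x (∑ i ∈ s, y i) = ∑ i ∈ s, pairQ M x (y i) := by
  induction s using Finset.induction_on with
  | empty => simp [pairQ_zero_right]
  | insert i s hi ih => rw [Finset.sum_insert hi, Finset.sum_insert hi, pairQ_add_right, ih]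

theorem pairQ_comm (hsym : ∀ u v, M u v = M v u) (x y : V → ℚ) :
    pairQ M x y = pairQ M y x := by
  unfold pairQ
  rw [Finset.sum_comm]
  refine Finset.sum_congr rfl fun u _ => Finset.sum_congr rfl fun v _ => ?_
  rw [hsym v u]
  ring

theorem pairQ_toQ_isInt (a b : V → ℤ) : ∃ n : ℤ, pairQ M (toQ a) (toQ b) = n :=
  ⟨∑ u, ∑ v, a u * M u v * b v, by simp [pairQ, toQ]⟩

theorem pairQ_toQ_eq_zero {a b : V → ℤ}
    (h : ∀ u v, a u ≠ 0 → b v ≠ 0 → M u v = 0) : pairQ M (toQ a) (toQ b) = 0 := by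
  refine Finset.sum_eq_zero fun u _ => Finset.sum_eq_zero fun v _ => ?_
  by_cases hu : a u = 0
  · simp [toQ, hu]
  by_cases hv : b v = 0
  · simp [toQ, hv]
  simp [h u v hu hv]

/-- The increment `χ(−l' + l) − χ(−l') = χ(l) + (l', l)`. -/
def chiIncr (ZK l' : V → ℚ) (l : V → ℤ) : ℚ :=
  chiQ M ZK (toQ l) + pairQ M l' (toQ l)

variable (ZK l' : V → ℚ)

theorem chiQ_add (hsym : ∀ u v, M u v = M v u) (x y : V → ℚ) :
    chiQ M ZK (x + y) = chiQ M ZK x + chiQ M ZK y - pairQ M x y := by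
  simp only [chiQ, sub_eq_add_neg, pairQ_add_left, pairQ_add_right, pairQ_comm M hsym y x]
  ring

theorem chiQ_neg_add_toQ (hsym : ∀ u v, M u v = M v u) (l : V → ℤ) :
    chiQ M ZK (-l' + toQ l) = chiQ M ZK (-l') + chiIncr M ZK l' l := by
  rw [chiQ_add M ZK hsym, pairQ_neg_left, chiIncr]
  ring

theorem chiIncr_zero : chiIncr M ZK l' 0 = 0 := by
  simp [chiIncr, chiQ, toQ_zero, pairQ_zero_left, pairQ_zero_right]

theorem chiIncr_add (hsym : ∀ u v, M u v = M v u) (a b : V → ℤ) :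
    chiIncr M ZK l' (a + b) =
      chiIncr M ZK l' a + chiIncr M ZK l' b - pairQ M (toQ a) (toQ b) := by
  simp only [chiIncr, toQ_add, chiQ_add M ZK hsym, pairQ_add_right]
  ring

theorem chiIncr_sum (hsym : ∀ u v, M u v = M v u) {ι : Type*} (s : Finset ι) (a : ι → V → ℤ)
    (horth : ∀ i j, i ≠ j → pairQ M (toQ (a i)) (toQ (a j)) = 0) :
    chiIncr M ZK l' (∑ i ∈ s, a i) = ∑ i ∈ s, chiIncr M ZK l' (a i) := by
  induction s using Finset.induction_on with
  | empty => simp [chiIncr_zero]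
  | insert i s hi ih =>
    rw [Finset.sum_insert hi, Finset.sum_insert hi, chiIncr_add M ZK l' hsym, ih, toQ_sum,
      pairQ_sum_right, Finset.sum_eq_zero fun j hj => horth i j fun hij => hi (hij ▸ hj), sub_zero]

theorem chiIncr_single_isInt [DecidableEq V] (hsym : ∀ u v, M u v = M v u)
    (hZK : ∀ v, pairQ M ZK (Pi.single v 1) = (M v v : ℚ) + 2)
    (hl' : ∀ v, ∃ n : ℤ, pairQ M l' (Pi.single v 1) = n) (v : V) :
    ∃ n : ℤ, chiIncr M ZK l' (Pi.single v 1) = n := by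
  obtain ⟨n, hn⟩ := hl' v
  have hself : pairQ M (Pi.single v 1) (Pi.single v 1) = M v v := by
    simp [pairQ, Pi.single_apply]
  refine ⟨1 + n, ?_⟩
  rw [chiIncr, toQ_single, chiQ, sub_eq_add_neg, pairQ_add_right, pairQ_neg_right,
    pairQ_comm M hsym _ ZK, hZK, hself, hn]
  push_cast
  ring

theorem chiIncr_isInt [DecidableEq V] (hsym : ∀ u v, M u v = M v u)
    (hZK : ∀ v, pairQ M ZK (Pi.single v 1) = (M v v : ℚ) + 2)
    (hl' : ∀ v, ∃ n : ℤ, pairQ M l' (Pi.single v 1) = n) (l : V → ℤ) :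
    ∃ n : ℤ, chiIncr M ZK l' l = n := by
  let H : AddSubgroup (V → ℤ) :=
    { carrier := {l | ∃ n : ℤ, chiIncr M ZK l' l = n}
      zero_mem' := ⟨0, by simp [chiIncr_zero]⟩
      add_mem' := by
        rintro a b ⟨m, hm⟩ ⟨n, hn⟩
        obtain ⟨k, hk⟩ := pairQ_toQ_isInt M a b
        exact ⟨m + n - k, by rw [chiIncr_add M ZK l' hsym, hm, hn, hk]; push_cast; ring⟩
      neg_mem' := by
        rintro a ⟨m, hm⟩
        obtain ⟨k, hk⟩ := pairQ_toQ_isInt M a (-a)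
        have h := chiIncr_add M ZK l' hsym a (-a)
        rw [add_neg_cancel, chiIncr_zero, hm, hk] at h
        exact ⟨k - m, by push_cast; linarith⟩ }
  have hl : l = ∑ v, l v • (Pi.single v 1 : V → ℤ) := by
    ext u; simp [Finset.sum_apply, Pi.single_apply]
  have : l ∈ H := by
    rw [hl]
    exact H.sum_mem fun v _ =>
      H.zsmul_mem (chiIncr_single_isInt M ZK l' hsym hZK hl' v) (l v)
  exact this

end Pairing

section Components

variable {V : Type} (M : Matrix V V ℤ)

theorem compCycle_apply_ne_zero {Z : V → ℤ} {c : (inducedOnSupp M Z).ConnectedComponent} {v : V} :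
    compCycle M Z c v ≠ 0 ↔
      ∃ h : Z v ≠ 0, (inducedOnSupp M Z).connectedComponentMk ⟨v, h⟩ = c := by
  unfold compCycle
  by_cases h : Z v = 0
  · simp [h]
  · by_cases h' : (inducedOnSupp M Z).connectedComponentMk ⟨v, h⟩ = c <;> simp [h, h']

theorem compCycle_apply_of_ne_zero {Z : V → ℤ} {c : (inducedOnSupp M Z).ConnectedComponent}
    {v : V} (h : compCycle M Z c v ≠ 0) : compCycle M Z c v = Z v := by
  obtain ⟨h₁, h₂⟩ := (compCycle_apply_ne_zero M).1 h
  simp [compCycle, h₁, h₂]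

theorem compCycle_nonneg {Z : V → ℤ} (hZ : 0 ≤ Z) (c : (inducedOnSupp M Z).ConnectedComponent) :
    0 ≤ compCycle M Z c := by
  intro v
  by_cases h : compCycle M Z c v = 0
  · exact h.ge
  · rw [compCycle_apply_of_ne_zero M h]; exact hZ v

theorem compCycle_ne_zero {Z : V → ℤ} (c : (inducedOnSupp M Z).ConnectedComponent) :
    compCycle M Z c ≠ 0 := by
  induction c using SimpleGraph.ConnectedComponent.ind with
  | h v => exact fun h => (compCycle_apply_ne_zero M).2 ⟨v.2, rfl⟩ (congrFun h v.1)

theorem compCycle_pos {Z : V → ℤ} (hZ : 0 ≤ Z) (c : (inducedOnSupp M Z).ConnectedComponent) :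
    0 < compCycle M Z c :=
  lt_of_le_of_ne (compCycle_nonneg M hZ c) (compCycle_ne_zero M c).symm

theorem component_eq_of_compCycle_ne_zero {Z : V → ℤ}
    {c d : (inducedOnSupp M Z).ConnectedComponent} {v : V}
    (hc : compCycle M Z c v ≠ 0) (hd : compCycle M Z d v ≠ 0) : c = d := by
  obtain ⟨_, rfl⟩ := (compCycle_apply_ne_zero M).1 hc
  obtain ⟨_, rfl⟩ := (compCycle_apply_ne_zero M).1 hd
  rfl

theorem apply_eq_zero_of_component_ne (hoff : ∀ u v : V, u ≠ v → 0 ≤ M u v) {Z : V → ℤ}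
    {c d : (inducedOnSupp M Z).ConnectedComponent} (hcd : c ≠ d) {u v : V}
    (hu : compCycle M Z c u ≠ 0) (hv : compCycle M Z d v ≠ 0) : M u v = 0 := by
  have huv : u ≠ v := by
    rintro rfl
    exact hcd (component_eq_of_compCycle_ne_zero M hu hv)
  by_contra hne
  obtain ⟨hu', rfl⟩ := (compCycle_apply_ne_zero M).1 hu
  obtain ⟨hv', rfl⟩ := (compCycle_apply_ne_zero M).1 hv
  apply hcd
  apply SimpleGraph.ConnectedComponent.connectedComponentMk_eq_of_adj
  exact ⟨huv, Or.inl (lt_of_le_of_ne (hoff u v huv) (Ne.symm hne))⟩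

variable [Fintype V]

noncomputable instance (Z : V → ℤ) : Fintype (inducedOnSupp M Z).ConnectedComponent := Fintype.ofFinite _

theorem sumComp_eq_sum (F : (V → ℤ) → ℚ) (Z : V → ℤ) :
    sumComp M F Z = ∑ c, F (compCycle M Z c) :=
  finsum_eq_sum_of_fintype _

/-- If each `a d` is supported on the component `d`, then `Σ_d a d` has coordinates `a c v`
on the component `c`. -/
theorem sum_apply_of_supported {Z : V → ℤ}
    (a : (inducedOnSupp M Z).ConnectedComponent → V → ℤ)
    (ha : ∀ c v, a c v ≠ 0 → compCycle M Z c v ≠ 0)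
    {c : (inducedOnSupp M Z).ConnectedComponent} {v : V} (hv : compCycle M Z c v ≠ 0) :
    (∑ d, a d) v = a c v := by
  rw [Finset.sum_apply]
  refine Finset.sum_eq_single_of_mem c (Finset.mem_univ c) fun d _ hdc => ?_
  by_contra h
  exact hdc (component_eq_of_compCycle_ne_zero M (ha d v h) hv)

theorem sum_compCycle (Z : V → ℤ) : ∑ c, compCycle M Z c = Z := by
  ext v
  by_cases h : Z v = 0
  · rw [h, Finset.sum_apply]
    exact Finset.sum_eq_zero fun c _ => by simp [compCycle, h]
  · have hv := (compCycle_apply_ne_zero M).2 ⟨h, rfl⟩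
    rw [sum_apply_of_supported M _ (fun _ _ => id) hv, compCycle_apply_of_ne_zero M hv]

theorem chiIncr_sum_of_supported (hsym : ∀ u v, M u v = M v u)
    (hoff : ∀ u v : V, u ≠ v → 0 ≤ M u v) (ZK l' : V → ℚ) {Z : V → ℤ}
    (a : (inducedOnSupp M Z).ConnectedComponent → V → ℤ)
    (ha : ∀ c v, a c v ≠ 0 → compCycle M Z c v ≠ 0) :
    chiIncr M ZK l' (∑ c, a c) = ∑ c, chiIncr M ZK l' (a c) :=
  chiIncr_sum M ZK l' hsym _ _ fun c d hcd => pairQ_toQ_eq_zero M fun u v hu hv =>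
    apply_eq_zero_of_component_ne M hoff hcd (ha c u hu) (ha d v hv)

/-- Every component of `Z` carrying a nonzero `a c` contains a component of `Σ_c a c`. -/
theorem card_ne_zero_le_card_component {Z : V → ℤ}
    (a : (inducedOnSupp M Z).ConnectedComponent → V → ℤ)
    (ha : ∀ c v, a c v ≠ 0 → compCycle M Z c v ≠ 0) :
    (Finset.univ.filter fun c => a c ≠ 0).card ≤
      Fintype.card (inducedOnSupp M (∑ c, a c)).ConnectedComponent := by
  have hsub : supp (∑ c, a c) ≤ supp Z := by
    intro v hv
    have hv' : (∑ c, a c) v ≠ 0 := hv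
    rw [Finset.sum_apply] at hv'
    obtain ⟨c, -, hc⟩ := Finset.exists_ne_zero_of_sum_ne_zero hv'
    exact ((compCycle_apply_ne_zero M).1 (ha c v hc)).1
  let φ := SimpleGraph.induceHomOfLE (dualGraph M) hsub
  refine Finset.card_le_card_of_surjOn (s := Finset.univ)
    (SimpleGraph.ConnectedComponent.map φ.toHom) ?_
  intro c hc
  obtain ⟨v, hv⟩ := Function.ne_iff.1 (by simpa using hc : a c ≠ 0)
  have hW : (∑ d, a d) v ≠ 0 := by
    rwa [sum_apply_of_supported M a ha (ha c v hv)]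
  refine ⟨(inducedOnSupp M (∑ c, a c)).connectedComponentMk ⟨v, hW⟩, by simp, ?_⟩
  obtain ⟨_, rfl⟩ := (compCycle_apply_ne_zero M).1 (ha c v hv)
  rfl

theorem card_sub_chiIncr_le_sumComp (hsym : ∀ u v, M u v = M v u)
    (hoff : ∀ u v : V, u ≠ v → 0 ≤ M u v) (ZK l' : V → ℚ) (T : (V → ℤ) → ℚ)
    (hT : ∀ W, 0 < W → 1 - chiIncr M ZK l' W ≤ T W) {W : V → ℤ} (hW : 0 ≤ W) :
    Fintype.card (inducedOnSupp M W).ConnectedComponent - chiIncr M ZK l' W ≤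
      sumComp M T W := by
  have hsum := chiIncr_sum_of_supported M hsym hoff ZK l' (compCycle M W) fun _ _ => id
  rw [sum_compCycle] at hsum
  calc _ = ∑ c, (1 - chiIncr M ZK l' (compCycle M W c)) := by
        rw [hsum, Finset.sum_sub_distrib]; simp
    _ ≤ _ := by
        rw [sumComp_eq_sum]
        exact Finset.sum_le_sum fun c _ => hT _ (compCycle_pos M hW c)

/-- If `T(W) ≥ 1 − f(W)` for all `W > 0`, where `f` is the increment of `χ`, and on every `W > 0`
the value `T(W)` is `0` or is attained as `1 − f(l)` for some `0 < l ≤ W`, then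
`T(Z_c) = 1 − f(Z_c)` on each component of a minimal maximizer `Z` of `Σ_c T(Z_c)`. -/
theorem eq_one_sub_chiIncr_of_minimal (hsym : ∀ u v, M u v = M v u)
    (hoff : ∀ u v : V, u ≠ v → 0 ≤ M u v) (ZK l' : V → ℚ) (T : (V → ℤ) → ℚ)
    (hT : ∀ W, 0 < W → 1 - chiIncr M ZK l' W ≤ T W)
    (hattain : ∀ W, 0 < W → ∃ l, 0 ≤ l ∧ l ≤ W ∧
      T W = (if l ≠ 0 then 1 else 0) - chiIncr M ZK l' l)
    {Z : V → ℤ} (hZ : 0 < Z) (hpos : 0 < sumComp M T Z)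
    (hmax : ∀ W, 0 < W → W ≤ Z → sumComp M T W ≤ sumComp M T Z)
    (hmin : ∀ W, 0 < W → W ≤ Z → sumComp M T W = sumComp M T Z → W = Z)
    (c : (inducedOnSupp M Z).ConnectedComponent) :
    T (compCycle M Z c) = 1 - chiIncr M ZK l' (compCycle M Z c) := by
  choose a ha0 haZ haT using fun c => hattain _ (compCycle_pos M hZ.le c)
  have hsupp : ∀ c v, a c v ≠ 0 → compCycle M Z c v ≠ 0 := fun c v h h' =>
    h (le_antisymm (h' ▸ haZ c v) (ha0 c v))
  have hW0 : 0 ≤ ∑ c, a c := Finset.sum_nonneg fun c _ => ha0 c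
  have hWZ : ∑ c, a c ≤ Z := by
    conv_rhs => rw [← sum_compCycle M Z]
    exact Finset.sum_le_sum fun c _ => haZ c
  have hsumZ : sumComp M T Z =
      (Finset.univ.filter fun c => a c ≠ 0).card - chiIncr M ZK l' (∑ c, a c) := by
    rw [sumComp_eq_sum, Finset.sum_congr rfl fun c _ => haT c, Finset.sum_sub_distrib,
      Finset.sum_boole, chiIncr_sum_of_supported M hsym hoff ZK l' a hsupp]
  have hne : ∑ c, a c ≠ 0 := by
    intro h
    have hz : ∀ c, a c = 0 := fun c =>
      (Finset.sum_eq_zero_iff_of_nonneg fun c _ => ha0 c).1 h c (Finset.mem_univ c)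
    rw [hsumZ, h, chiIncr_zero] at hpos
    simp [hz] at hpos
  have hWpos : 0 < ∑ c, a c := lt_of_le_of_ne hW0 hne.symm
  have hle : sumComp M T Z ≤ sumComp M T (∑ c, a c) := by
    refine le_trans ?_ (card_sub_chiIncr_le_sumComp M hsym hoff ZK l' T hT hW0)
    rw [hsumZ]
    exact sub_le_sub_right (by exact_mod_cast card_ne_zero_le_card_component M a hsupp) _
  have hWeq := hmin _ hWpos hWZ (le_antisymm (hmax _ hWpos hWZ) hle)
  have hac : a c = compCycle M Z c := by
    ext v
    by_cases hv : compCycle M Z c v = 0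
    · rw [hv]
      by_contra h
      exact hsupp c v h hv
    · rw [← sum_apply_of_supported M a hsupp hv, hWeq, compCycle_apply_of_ne_zero M hv]
  rw [haT c, hac, if_pos (compCycle_ne_zero M c)]

end Components

/-- Lemma 6.6(c).  For a `≤`-minimal maximizer `Z'` one has
`t(Z,l') = Σ_i ( −(l',Z'_i) − χ(Z'_i) + 1 )`, the sum over the connected
components of `Z'`. -/
theorem stmt_7
    (V : Type) [Fintype V] [DecidableEq V] [Nonempty V]
    (M : Matrix V V ℤ)
    (hsym : ∀ u v, M u v = M v u)
    (hneg : ∀ x : V → ℚ, x ≠ 0 → pairQ M x x < 0)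
    (hoff : ∀ u v : V, u ≠ v → 0 ≤ M u v)
    (hconn : (dualGraph M).Connected)
    (ZK : V → ℚ)
    (hZK : ∀ v, pairQ M ZK (Pi.single v 1) = (M v v : ℚ) + 2)
    (l' : V → ℚ)
    (hl' : ∀ v, ∃ n : ℕ, pairQ M l' (Pi.single v 1) = n)
    (Z : V → ℤ) (hZ : ∀ v, 1 ≤ Z v)
    (hnotdom : ∃ l : V → ℤ, 0 < l ∧ l ≤ Z ∧
      chiQ M ZK (-l' + toQ l) ≤ chiQ M ZK (-l'))
    -- `D` : the dominance defect
    (D : (V → ℤ) → ℚ)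
    (hD0 : ∀ W : V → ℤ,
      (∀ l : V → ℤ, 0 < l → l ≤ W → chiQ M ZK (-l') < chiQ M ZK (-l' + toQ l)) →
      D W = 0)
    (hD1 : ∀ W : V → ℤ,
      (∃ l : V → ℤ, 0 < l ∧ l ≤ W ∧ chiQ M ZK (-l' + toQ l) ≤ chiQ M ZK (-l')) →
      D W = 1)
    -- `μ W = min_{0 ≤ l ≤ W} χ(−l' + l)`
    (μ : (V → ℤ) → ℚ)
    (hμ : ∀ W : V → ℤ, 0 ≤ W →
      IsLeast {q : ℚ | ∃ l : V → ℤ, 0 ≤ l ∧ l ≤ W ∧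
        q = chiQ M ZK (-l' + toQ l)} (μ W))
    -- `t = t(Z,l') = max_{0<Z''≤Z} Σ_i T(Z''_i,l')`, `T(W,l') = χ(−l') − μ W + D W`
    (t : ℚ)
    (ht : IsGreatest {q : ℚ | ∃ W : V → ℤ, 0 < W ∧ W ≤ Z ∧
      q = sumComp M (fun W' => chiQ M ZK (-l') - μ W' + D W') W} t)
    -- `Z'` is a `≤`-minimal realizing cycle
    (Z' : V → ℤ) (hZ'pos : 0 < Z') (hZ'le : Z' ≤ Z)
    (hZ'max : sumComp M (fun W' => chiQ M ZK (-l') - μ W' + D W') Z' = t)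
    (hZ'min : ∀ W : V → ℤ, 0 < W → W ≤ Z →
      sumComp M (fun W' => chiQ M ZK (-l') - μ W' + D W') W = t → W ≤ Z' → W = Z') :
    t = sumComp M
      (fun W' => -(pairQ M l' (toQ W')) - chiQ M ZK (toQ W') + 1) Z' := by
  set T : (V → ℤ) → ℚ := fun W' => chiQ M ZK (-l') - μ W' + D W' with hTdef
  have hχ := chiQ_neg_add_toQ M ZK l' hsym
  have hint := chiIncr_isInt M ZK l' hsym hZK fun v =>
    let ⟨n, hn⟩ := hl' v; ⟨n, by simpa using hn⟩
  have hf0 := chiIncr_zero M ZK l'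
  have hμle : ∀ W l : V → ℤ, 0 ≤ l → l ≤ W → μ W ≤ chiQ M ZK (-l') + chiIncr M ZK l' l :=
    fun W l h0 hl => hχ l ▸ (hμ W (h0.trans hl)).2 ⟨l, h0, hl, rfl⟩
  have hT : ∀ W, 0 < W → 1 - chiIncr M ZK l' W ≤ T W := by
    intro W hW
    by_cases h : ∃ l : V → ℤ, 0 < l ∧ l ≤ W ∧ chiQ M ZK (-l' + toQ l) ≤ chiQ M ZK (-l')
    · have := hμle W W hW.le le_rfl
      simp only [hTdef, hD1 W h]
      linarith
    · push Not at h
      have h0 := hμle W 0 le_rfl hW.le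
      have hWpos := h W hW le_rfl
      obtain ⟨n, hn⟩ := hint W
      rw [hχ, hn] at hWpos
      have hn1 : (1 : ℚ) ≤ n := by
        have : (0 : ℚ) < n := by linarith
        exact_mod_cast this
      simp only [hTdef, hD0 W h, hn]
      linarith
  have hattain : ∀ W, 0 < W → ∃ l, 0 ≤ l ∧ l ≤ W ∧
      T W = (if l ≠ 0 then 1 else 0) - chiIncr M ZK l' l := by
    intro W hW
    have h0 := hμle W 0 le_rfl hW.le
    obtain ⟨m, hm0, hmW, hm⟩ := (hμ W hW.le).1
    rw [hχ] at hm
    by_cases h : ∃ l : V → ℤ, 0 < l ∧ l ≤ W ∧ chiQ M ZK (-l' + toQ l) ≤ chiQ M ZK (-l')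
    · by_cases hm' : m = 0
      · obtain ⟨l, hl0, hlW, hl⟩ := h
        have := hμle W l hl0.le hlW
        rw [hχ] at hl
        rw [hm', hf0] at hm
        refine ⟨l, hl0.le, hlW, ?_⟩
        simp only [hTdef, hD1 W ⟨l, hl0, hlW, by rw [hχ]; exact hl⟩, if_pos hl0.ne']
        linarith
      · refine ⟨m, hm0, hmW, ?_⟩
        simp only [hTdef, hD1 W h, if_pos hm']
        linarith
    · push Not at h
      refine ⟨0, le_rfl, hW.le, ?_⟩
      have hm' : m = 0 := by
        by_contra hne
        have := h m (lt_of_le_of_ne hm0 (Ne.symm hne)) hmW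
        rw [hχ] at this
        linarith
      rw [hm'] at hm
      simp only [hTdef, hD0 W h, ne_eq, not_true_eq_false, if_false]
      linarith
  have hpos : 0 < t := by
    obtain ⟨l, hl0, hlZ, hl⟩ := hnotdom
    have hle := ht.2 ⟨l, hl0, hlZ, rfl⟩
    have hcard := card_sub_chiIncr_le_sumComp M hsym hoff ZK l' T hT hl0.le
    obtain ⟨v, hv⟩ := Function.ne_iff.1 hl0.ne'
    have : 0 < Fintype.card (inducedOnSupp M l).ConnectedComponent :=
      Fintype.card_pos_iff.2 ⟨(inducedOnSupp M l).connectedComponentMk ⟨v, hv⟩⟩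
    have : (0 : ℚ) < Fintype.card (inducedOnSupp M l).ConnectedComponent := by exact_mod_cast this
    rw [hχ] at hl
    linarith
  have key := eq_one_sub_chiIncr_of_minimal M hsym hoff ZK l' T hT hattain hZ'pos
    (hZ'max ▸ hpos)
    (fun W h0 hW => hZ'max ▸ ht.2 ⟨W, h0, hW.trans hZ'le, rfl⟩)
    (fun W h0 hW h => hZ'min W h0 (hW.trans hZ'le) (h.trans hZ'max) hW)
  rw [← hZ'max, sumComp_eq_sum, sumComp_eq_sum]
  refine Finset.sum_congr rfl fun c _ => ?_
  rw [key c, chiIncr]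
  ring
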